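/- Let λ ∈ ℂ, λ ≠ 0. In ℂ[b,c,d] define a := λ⁻²(bc − d²), e := λ⁻¹(ad − c³), f := λ⁻¹(ab − c²d), and E := λ⁻²(a²b − 2ac²d + c⁵) + b⁶. Then the following identities hold in ℂ[b,c,d]: (i) be − df = −λac² and de − cf = −λa² (so the 4th and 5th equations of the family X(λ) are automatically satisfied); (ii) af − c²e + λb⁶ = λE, e² + a³ + b⁶c = cE, ef + a²c² + b⁶d = dE, and f² + ac⁴ + b⁷ = bE (so for λ ≠ 0 the remaining equations of X(λ) are equivalent to the single hypersurface equation E = 0). Moreover, for λ = 1 and (b,c,d) = (z,y,x), one has E = z(yz − x²)² − 2xy²(yz − x²) + y⁵ + z⁶, the superisolated quintic f₅ + z⁶. -/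

import Mathlib

open MvPolynomial

/-- Let `λ ∈ ℂ`, `λ ≠ 0`.  In `ℂ[b,c,d]` (with `b = X 0`, `c = X 1`, `d = X 2`) define
`a = λ⁻²(bc − d²)`, `e = λ⁻¹(ad − c³)`, `f = λ⁻¹(ab − c²d)` and
`E = λ⁻²(a²b − 2ac²d + c⁵) + b⁶`.  Then (i) `be − df = −λac²` and `de − cf = −λa²`;
(ii) `af − c²e + λb⁶ = λE`, `e² + a³ + b⁶c = cE`, `ef + a²c² + b⁶d = dE` and
`f² + ac⁴ + b⁷ = bE`.  Moreover, for `λ = 1` and `(b,c,d) = (z,y,x)`, `E` is the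
superisolated quintic `z(yz − x²)² − 2xy²(yz − x²) + y⁵ + z⁶`. -/
theorem deformation_X_lambda (lam : ℂ) (hlam : lam ≠ 0) :
    letI b : MvPolynomial (Fin 3) ℂ := X 0
    letI c : MvPolynomial (Fin 3) ℂ := X 1
    letI d : MvPolynomial (Fin 3) ℂ := X 2
    letI a := C lam⁻¹ ^ 2 * (b * c - d ^ 2)
    letI e := C lam⁻¹ * (a * d - c ^ 3)
    letI f := C lam⁻¹ * (a * b - c ^ 2 * d)
    letI E := C lam⁻¹ ^ 2 * (a ^ 2 * b - 2 * a * c ^ 2 * d + c ^ 5) + b ^ 6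
    (b * e - d * f = -(C lam) * (a * c ^ 2)) ∧
    (d * e - c * f = -(C lam) * a ^ 2) ∧
    (a * f - c ^ 2 * e + C lam * b ^ 6 = C lam * E) ∧
    (e ^ 2 + a ^ 3 + b ^ 6 * c = c * E) ∧
    (e * f + a ^ 2 * c ^ 2 + b ^ 6 * d = d * E) ∧
    (f ^ 2 + a * c ^ 4 + b ^ 7 = b * E) ∧
    -- For `λ = 1`, writing `a₁ = bc − d²`, the hypersurface equation `E` becomes the
    -- superisolated quintic `f₅ + z⁶` under `(b,c,d) = (z,y,x)`:
    ((b * c - d ^ 2) ^ 2 * b - 2 * (b * c - d ^ 2) * c ^ 2 * d + c ^ 5 + b ^ 6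
      = b * (c * b - d ^ 2) ^ 2 - 2 * d * c ^ 2 * (c * b - d ^ 2) + c ^ 5 + b ^ 6) := by
  have hL : (C lam : MvPolynomial (Fin 3) ℂ) * C lam⁻¹ = 1 := by
    rw [← C_mul, mul_inv_cancel₀ hlam, C_1]
  generalize (X 0 : MvPolynomial (Fin 3) ℂ) = b, (X 1 : MvPolynomial (Fin 3) ℂ) = c,
    (X 2 : MvPolynomial (Fin 3) ℂ) = d
  generalize ha : C lam⁻¹ ^ 2 * (b * c - d ^ 2) = a
  refine ⟨?_, ?_, ?_, ?_, ?_, ?_, ?_⟩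
  · linear_combination c ^ 2 * (-C lam * ha + C lam⁻¹ * (b * c - d ^ 2) * hL)
  · linear_combination a * (-C lam * ha + C lam⁻¹ * (b * c - d ^ 2) * hL)
  · linear_combination -C lam⁻¹ * (a ^ 2 * b - 2 * a * c ^ 2 * d + c ^ 5) * hL
  · linear_combination -a ^ 2 * ha
  · linear_combination -a * c ^ 2 * ha
  · linear_combination -c ^ 4 * ha
  · ring
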